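/- arXiv:1504.00194 — 2 statements merged into one kernel-verified Lean document; each statement's English description precedes it below -/
import Mathlib

section
/- Let D be a division ring, σ a ring automorphism of D, and d ∈ D. The twisted polynomial f(t) = t⁴ − d is irreducible in D[t;σ] if and only if: d ≠ σ³(z)·σ²(z)·σ(z)·z for all z ∈ D, and for all z₀, z₁ ∈ D one has σ²(z₁)σ(z₁)z₁ + σ²(z₀)z₁ + σ²(z₁)σ(z₀) ≠ 0 or σ²(z₀)z₀ + σ²(z₁)σ(z₁)z₀ ≠ d. -/
/-!
Twisted polynomial ring `D[t;σ]` over a division ring `D`, modeled on finitely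
supported functions `ℕ →₀ D` recording left coefficients: `f = ∑ f i * t ^ i`,
with multiplication determined by `(a t^i) (b t^j) = a σ^i(b) t^{i+j}`.
-/

/-- Multiplication in the twisted polynomial ring `D[t;σ]`. -/
noncomputable def tMul {D : Type*} [DivisionRing D] (σ : D ≃+* D) (f g : ℕ →₀ D) : ℕ →₀ D :=
  f.sum fun i a => g.sum fun j b => Finsupp.single (i + j) (a * (σ ^ i) b)

/-- The degree of a twisted polynomial (`⊥` for the zero polynomial). -/
noncomputable def tDeg {D : Type*} [DivisionRing D] (f : ℕ →₀ D) : WithBot ℕ := f.support.max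

/-- A twisted polynomial of positive degree is irreducible iff it admits no factorization
`f = g * h` with `deg g < deg f` and `deg h < deg f`. -/
def tIrred {D : Type*} [DivisionRing D] (σ : D ≃+* D) (f : ℕ →₀ D) : Prop :=
  ¬ ∃ g h : ℕ →₀ D, tDeg g < tDeg f ∧ tDeg h < tDeg f ∧ f = tMul σ g h

/-- The coefficients of a product in `D[t;σ]`. -/
theorem tMul_apply {D : Type*} [DivisionRing D] (σ : D ≃+* D) (g h : ℕ →₀ D) (n : ℕ) :
    tMul σ g h n = ∑ p ∈ Finset.HasAntidiagonal.antidiagonal n, g p.1 * (σ ^ p.1) (h p.2) := by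
  classical
  simp only [tMul, Finsupp.sum, Finsupp.finsetSum_apply, Finsupp.single_apply]
  rw [← Finset.sum_product', ← Finset.sum_filter]
  refine Finset.sum_subset (fun p hp => ?_) (fun p hp hp' => ?_)
  · simpa using (Finset.mem_filter.mp hp).2
  · by_cases hg : g p.1 = 0
    · simp [hg]
    · have : h p.2 = 0 := by
        by_contra hh
        exact hp' (by simpa [hg, hh] using hp)
      simp [this]

theorem tDeg_lt_natCast_iff {D : Type*} [DivisionRing D] (f : ℕ →₀ D) (n : ℕ) :
    tDeg f < n ↔ ∀ m, n ≤ m → f m = 0 := by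
  rw [tDeg, Finset.max_eq_sup_withBot]
  refine (Finset.sup_lt_iff (WithBot.bot_lt_coe n)).trans ?_
  refine ⟨fun H m hm => ?_, fun H m hm => ?_⟩
  · by_contra hf
    have := H m (by simpa using hf)
    exact absurd (WithBot.coe_lt_coe.mp this) (not_lt.mpr hm)
  · refine WithBot.coe_lt_coe.mpr (lt_of_not_ge fun hle => ?_)
    exact (Finsupp.mem_support_iff.mp hm) (H m hle)

theorem tDeg_quartic {D : Type*} [DivisionRing D] (d : D) :
    tDeg (Finsupp.single 4 (1 : D) - Finsupp.single 0 d) = (4 : ℕ) := by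
  refine le_antisymm (Finset.max_le fun m hm => ?_) (Finset.le_max (by simp))
  refine WithBot.coe_le_coe.mpr (le_of_not_gt fun hlt => ?_)
  refine (Finsupp.mem_support_iff.mp hm) ?_
  simp [show 4 ≠ m by omega, show 0 ≠ m by omega]

/-- For `g = ∑ aᵢ tⁱ` and `h = ∑ bᵢ tⁱ` of degree at most three, the equation `g * h = t⁴ - d`
written coefficientwise. -/
def IsQuarticFactorization {D : Type*} [DivisionRing D] (σ : D ≃+* D) (d : D)
    (a₀ a₁ a₂ a₃ b₀ b₁ b₂ b₃ : D) : Prop :=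
  a₀ * b₀ = -d ∧
  a₀ * b₁ + a₁ * σ b₀ = 0 ∧
  a₀ * b₂ + a₁ * σ b₁ + a₂ * σ (σ b₀) = 0 ∧
  a₀ * b₃ + a₁ * σ b₂ + a₂ * σ (σ b₁) + a₃ * σ (σ (σ b₀)) = 0 ∧
  a₁ * σ b₃ + a₂ * σ (σ b₂) + a₃ * σ (σ (σ b₁)) = 1 ∧
  a₂ * σ (σ b₃) + a₃ * σ (σ (σ b₂)) = 0 ∧
  a₃ * σ (σ (σ b₃)) = 0

theorem quartic_eq_tMul_iff {D : Type*} [DivisionRing D] (σ : D ≃+* D) (d : D) (g h : ℕ →₀ D)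
    (hg : ∀ m, 4 ≤ m → g m = 0) (hh : ∀ m, 4 ≤ m → h m = 0) :
    Finsupp.single 4 (1 : D) - Finsupp.single 0 d = tMul σ g h ↔
      IsQuarticFactorization σ d (g 0) (g 1) (g 2) (g 3) (h 0) (h 1) (h 2) (h 3) := by
  have hs2 (x : D) : (σ ^ 2) x = σ (σ x) := rfl
  have hs3 (x : D) : (σ ^ 3) x = σ (σ (σ x)) := rfl
  rw [Finsupp.ext_iff]
  simp only [tMul_apply]
  constructor
  · intro H
    have e0 := H 0
    have e1 := H 1
    have e2 := H 2
    have e3 := H 3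
    have e4 := H 4
    have e5 := H 5
    have e6 := H 6
    simp [Finset.Nat.antidiagonal_succ, hg, hh] at e0 e1 e2 e3 e4 e5 e6
    exact ⟨e0.symm, by rw [e1], by rw [e2, add_assoc], by rw [e3]; simp only [add_assoc],
      by rw [e4, add_assoc], by rw [e5], by simpa using e6⟩
  · rintro ⟨e0, e1, e2, e3, e4, e5, e6⟩ n
    rcases lt_or_ge n 7 with hn | hn
    · interval_cases n <;>
        simp [Finset.Nat.antidiagonal_succ, ← add_assoc, -mul_eq_zero, -zero_eq_mul, *]
    · rw [Finset.sum_eq_zero]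
      · simp [show 4 ≠ n by omega, show 0 ≠ n by omega]
      · intro p hp
        have := Finset.HasAntidiagonal.mem_antidiagonal.mp hp
        rcases le_or_gt 4 p.1 with h1 | h1
        · simp [hg _ h1]
        · simp [hh p.2 (by omega)]

theorem tIrred_quartic_iff {D : Type*} [DivisionRing D] (σ : D ≃+* D) (d : D) :
    tIrred σ (Finsupp.single 4 (1 : D) - Finsupp.single 0 d) ↔
      ∀ a₀ a₁ a₂ a₃ b₀ b₁ b₂ b₃ : D,
        ¬ IsQuarticFactorization σ d a₀ a₁ a₂ a₃ b₀ b₁ b₂ b₃ := by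
  simp only [tIrred, tDeg_quartic, tDeg_lt_natCast_iff]
  constructor
  · intro H a₀ a₁ a₂ a₃ b₀ b₁ b₂ b₃ hab
    let cubic (c₀ c₁ c₂ c₃ : D) : ℕ →₀ D :=
      Finsupp.single 0 c₀ + Finsupp.single 1 c₁ + Finsupp.single 2 c₂ + Finsupp.single 3 c₃
    have hdeg (c₀ c₁ c₂ c₃ : D) (m : ℕ) (hm : 4 ≤ m) : cubic c₀ c₁ c₂ c₃ m = 0 := by
      simp [cubic, show 0 ≠ m by omega, show 1 ≠ m by omega,
        show 2 ≠ m by omega, show 3 ≠ m by omega]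
    refine H ⟨cubic a₀ a₁ a₂ a₃, cubic b₀ b₁ b₂ b₃, hdeg _ _ _ _, hdeg _ _ _ _, ?_⟩
    rw [quartic_eq_tMul_iff σ d _ _ (hdeg _ _ _ _) (hdeg _ _ _ _)]
    simpa [cubic, Finsupp.single_apply] using hab
  · rintro H ⟨g, h, hg, hh, e⟩
    exact H _ _ _ _ _ _ _ _ ((quartic_eq_tMul_iff σ d g h hg hh).mp e)

/-- A unit of `D` can be moved from the right factor to the left one. -/
theorem IsQuarticFactorization.scale {D : Type*} [DivisionRing D] {σ : D ≃+* D}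
    {d a₀ a₁ a₂ a₃ b₀ b₁ b₂ b₃ : D}
    (H : IsQuarticFactorization σ d a₀ a₁ a₂ a₃ b₀ b₁ b₂ b₃) {u : D} (hu : u ≠ 0) :
    IsQuarticFactorization σ d (a₀ * u) (a₁ * σ u) (a₂ * σ (σ u)) (a₃ * σ (σ (σ u)))
      (u⁻¹ * b₀) (u⁻¹ * b₁) (u⁻¹ * b₂) (u⁻¹ * b₃) := by
  have cancel (a b v : D) (hv : v ≠ 0) : a * v * (v⁻¹ * b) = a * b := by
    rw [mul_assoc, mul_inv_cancel_left₀ hv]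
  simpa [IsQuarticFactorization, cancel, hu] using H

theorem IsQuarticFactorization.right_linear {D : Type*} [DivisionRing D] {σ : D ≃+* D}
    {d a₀ a₁ a₂ a₃ b₀ : D}
    (H : IsQuarticFactorization σ d a₀ a₁ a₂ a₃ b₀ 1 0 0) :
    d = σ (σ (σ (-b₀))) * σ (σ (-b₀)) * σ (-b₀) * -b₀ := by
  obtain ⟨e0, e1, e2, e3, e4, -, -⟩ := H
  simp only [map_one, map_zero, mul_one, mul_zero, zero_add] at e0 e1 e2 e3 e4
  rw [← neg_eq_iff_eq_neg.mpr e0, eq_neg_of_add_eq_zero_left e1, eq_neg_of_add_eq_zero_left e2,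
    eq_neg_of_add_eq_zero_left e3, e4]
  simp

theorem IsQuarticFactorization.left_linear {D : Type*} [DivisionRing D] {σ : D ≃+* D}
    {d a₀ a₁ a₂ a₃ b₀ b₁ b₂ : D}
    (H : IsQuarticFactorization σ d a₀ a₁ a₂ a₃ b₀ b₁ b₂ 1) :
    ∃ z, d = σ (σ (σ z)) * σ (σ z) * σ z * z := by
  obtain ⟨e0, e1, e2, e3, e4, e5, e6⟩ := H
  obtain ⟨y, rfl⟩ := σ.surjective b₂
  obtain ⟨z, rfl⟩ := σ.surjective y
  obtain rfl : a₃ = 0 := by simpa using e6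
  obtain rfl : a₂ = 0 := by simpa using e5
  obtain rfl : a₁ = 1 := by simpa using e4
  have ha : a₀ = -σ (σ (σ z)) := eq_neg_of_add_eq_zero_left (by simpa using e3)
  subst ha
  have h1 : b₁ = σ (σ z) * σ z := σ.injective (by
    simpa using (neg_add_eq_zero.mp (by simpa using e2)).symm)
  subst h1
  have h0 : b₀ = σ (σ z) * σ z * z := σ.injective (by
    simpa [mul_assoc] using (neg_add_eq_zero.mp (by simpa using e1)).symm)
  subst h0
  exact ⟨z, by simpa [mul_assoc, eq_comm] using e0⟩

theorem IsQuarticFactorization.quadratic {D : Type*} [DivisionRing D] {σ : D ≃+* D}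
    {d a₀ a₁ a₂ a₃ b₀ b₁ : D}
    (H : IsQuarticFactorization σ d a₀ a₁ a₂ a₃ b₀ b₁ 1 0) :
    ∃ z₀ z₁, σ (σ z₁) * σ z₁ * z₁ + σ (σ z₀) * z₁ + σ (σ z₁) * σ z₀ = 0 ∧
      σ (σ z₀) * z₀ + σ (σ z₁) * σ z₁ * z₀ = d := by
  obtain ⟨e0, e1, e2, e3, e4, e5, -⟩ := H
  obtain rfl : a₃ = 0 := by simpa using e5
  obtain rfl : a₂ = 1 := by simpa using e4
  have h1 : a₁ = -σ (σ b₁) := eq_neg_of_add_eq_zero_left (by simpa using e3)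
  subst h1
  have h0 : a₀ = σ (σ b₁) * σ b₁ - σ (σ b₀) := by
    simp only [mul_one, one_mul] at e2
    rw [← sub_eq_zero, ← e2]
    noncomm_ring
  subst h0
  refine ⟨-b₀, -b₁, ?_, ?_⟩
  · simp only [map_neg]
    rw [← neg_eq_zero, ← e1]
    noncomm_ring
  · simp only [map_neg]
    rw [← neg_eq_iff_eq_neg.mpr e0]
    noncomm_ring

/-- `f(t) = t⁴ − d` is irreducible in `D[t;σ]` iff
`d ≠ σ³(z)σ²(z)σ(z)z` for all `z`, and for all `z₀, z₁` one has
`σ²(z₁)σ(z₁)z₁ + σ²(z₀)z₁ + σ²(z₁)σ(z₀) ≠ 0` or `σ²(z₀)z₀ + σ²(z₁)σ(z₁)z₀ ≠ d`. -/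
theorem quartic_irreducible_iff {D : Type*} [DivisionRing D] (σ : D ≃+* D) (d : D) :
    tIrred σ (Finsupp.single 4 (1 : D) - Finsupp.single 0 d) ↔
      ((∀ z : D, d ≠ (σ ^ 3) z * (σ ^ 2) z * σ z * z) ∧
        ∀ z₀ z₁ : D,
          (σ ^ 2) z₁ * σ z₁ * z₁ + (σ ^ 2) z₀ * z₁ + (σ ^ 2) z₁ * σ z₀ ≠ 0 ∨
          (σ ^ 2) z₀ * z₀ + (σ ^ 2) z₁ * σ z₁ * z₀ ≠ d) := by
  have hs2 (x : D) : (σ ^ 2) x = σ (σ x) := rfl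
  have hs3 (x : D) : (σ ^ 3) x = σ (σ (σ x)) := rfl
  simp only [tIrred_quartic_iff, hs2, hs3]
  constructor
  · refine fun H => ⟨fun z hz => ?_, fun z₀ z₁ => ?_⟩
    · refine H (σ (σ (σ z)) * σ (σ z) * σ z) (σ (σ (σ z)) * σ (σ z)) (σ (σ (σ z))) 1 (-z) 1 0 0 ?_
      simp [IsQuarticFactorization, hz]
    · by_contra! h
      obtain ⟨h1, h2⟩ := h
      refine H (σ (σ z₁) * σ z₁ + σ (σ z₀)) (σ (σ z₁)) 1 0 (-z₀) (-z₁) 1 0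
        ⟨?_, ?_, ?_, ?_, ?_, ?_, ?_⟩
      · rw [← h2]; noncomm_ring
      · rw [map_neg, ← neg_eq_zero, ← h1]; noncomm_ring
      all_goals simp
  · rintro ⟨H1, H2⟩ a₀ a₁ a₂ a₃ b₀ b₁ b₂ b₃ H
    by_cases h3 : b₃ = 0
    · subst h3
      by_cases h2 : b₂ = 0
      · subst h2
        have h1 : b₁ ≠ 0 := by
          rintro rfl
          simpa using H.2.2.2.2.1
        have := H.scale h1
        simp only [inv_mul_cancel₀ h1, mul_zero] at this
        exact H1 _ this.right_linear
      · have := H.scale h2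
        simp only [inv_mul_cancel₀ h2, mul_zero] at this
        obtain ⟨z₀, z₁, e1, e2⟩ := this.quadratic
        exact (H2 z₀ z₁).elim (· e1) (· e2)
    · have := H.scale h3
      simp only [inv_mul_cancel₀ h3] at this
      obtain ⟨z, hz⟩ := this.left_linear
      exact H1 z hz
end

section
/- Let D be a division ring, σ a ring automorphism of D, and z₀, z₁, d ∈ D. The unique remainder of right division of t⁴ − d by g(t) = t² − z₁t − z₀ in D[t;σ] (i.e., the r with deg(r) < 2 in t⁴ − d = q(t)·g(t) + r(t)) equals [σ²(z₁)σ(z₁)z₁ + σ²(z₀)z₁ + σ²(z₁)σ(z₀)]·t + [σ²(z₀)z₀ + σ²(z₁)σ(z₁)z₀ − d]. In particular, g(t) right divides t⁴ − d if and only if σ²(z₁)σ(z₁)z₁ + σ²(z₀)z₁ + σ²(z₁)σ(z₀) = 0 and σ²(z₀)z₀ + σ²(z₁)σ(z₁)z₀ = d. -/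
section TwistedMultiplication

variable {D : Type*} [DivisionRing D] (σ : D ≃+* D)

theorem tMul_add_left (p q g : ℕ →₀ D) : tMul σ (p + q) g = tMul σ p g + tMul σ q g := by
  unfold tMul
  refine Finsupp.sum_add_index' (fun i => by simp) fun i a b => ?_
  simp only [add_mul, Finsupp.single_add, Finsupp.sum_add]

theorem tMul_zero_left (g : ℕ →₀ D) : tMul σ 0 g = 0 := by
  simp [tMul]

theorem tMul_sub_left (p q g : ℕ →₀ D) : tMul σ (p - q) g = tMul σ p g - tMul σ q g := by
  rw [eq_sub_iff_add_eq, ← tMul_add_left, sub_add_cancel]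

theorem tMul_sub_right (p g h : ℕ →₀ D) : tMul σ p (g - h) = tMul σ p g - tMul σ p h := by
  unfold tMul
  rw [← Finsupp.sum_sub]
  refine Finsupp.sum_congr fun i _ => Finsupp.sum_sub_index fun j b c => ?_
  rw [map_sub, mul_sub, Finsupp.single_sub]

theorem tMul_single_single (i j : ℕ) (a b : D) :
    tMul σ (Finsupp.single i a) (Finsupp.single j b) =
      Finsupp.single (i + j) (a * (σ ^ i) b) := by
  simp [tMul]

/-- Coefficients of degree at least two of a left multiple of `t² − z₁ t − z₀`. -/
theorem tMul_quadratic_apply_add_two (z₀ z₁ : D) (q : ℕ →₀ D) (n : ℕ) :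
    tMul σ q (Finsupp.single 2 (1 : D) - Finsupp.single 1 z₁ - Finsupp.single 0 z₀) (n + 2) =
      q n - q (n + 1) * (σ ^ (n + 1)) z₁ - q (n + 2) * (σ ^ (n + 2)) z₀ := by
  induction q using Finsupp.induction_linear with
  | zero => simp [tMul_zero_left]
  | add p q hp hq =>
    rw [tMul_add_left, Finsupp.add_apply, hp, hq]
    simp only [Finsupp.add_apply, add_mul]
    abel
  | single i a =>
    simp only [tMul_sub_right, tMul_single_single, Finsupp.sub_apply, map_one, mul_one]
    simp only [Finsupp.single_apply, add_zero, Nat.add_right_cancel_iff, ite_mul, zero_mul,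
      show i + 1 = n + 2 ↔ i = n + 1 by omega]
    congr 1
    · congr 1
      split_ifs with h
      · rw [h]
      · rfl
    · split_ifs with h
      · rw [h]
      · rfl

theorem apply_eq_zero_of_tDeg_lt {f : ℕ →₀ D} {m n : ℕ} (hf : tDeg f < (m : ℕ)) (h : m ≤ n) :
    f n = 0 := by
  by_contra hn
  have hle : (n : WithBot ℕ) ≤ tDeg f := Finset.le_max (Finsupp.mem_support_iff.2 hn)
  exact absurd (WithBot.coe_lt_coe.1 (hle.trans_lt hf)) h.not_gt

theorem eq_zero_of_tMul_quadratic (z₀ z₁ : D) (q : ℕ →₀ D)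
    (h : ∀ n, tMul σ q
      (Finsupp.single 2 (1 : D) - Finsupp.single 1 z₁ - Finsupp.single 0 z₀) (n + 2) = 0) :
    q = 0 := by
  by_contra hq
  have hne : q.support.Nonempty := Finsupp.support_nonempty_iff.2 hq
  have hvanish : ∀ n, q.support.max' hne < n → q n = 0 := fun n hn => by
    by_contra hqn
    exact hn.not_ge (Finset.le_max' _ _ (Finsupp.mem_support_iff.2 hqn))
  refine Finsupp.mem_support_iff.1 (q.support.max'_mem hne) ?_
  have htop := h (q.support.max' hne)
  rwa [tMul_quadratic_apply_add_two, hvanish (q.support.max' hne + 1) (by omega),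
    hvanish (q.support.max' hne + 2) (by omega), zero_mul, zero_mul, sub_zero, sub_zero] at htop

/-- Remainders of right division by `t² − z₁ t − z₀` are unique. -/
theorem remainder_unique (z₀ z₁ : D) {p q r s : ℕ →₀ D}
    (hr : ∀ n, r (n + 2) = 0) (hs : ∀ n, s (n + 2) = 0)
    (h : tMul σ p (Finsupp.single 2 (1 : D) - Finsupp.single 1 z₁ - Finsupp.single 0 z₀) + r =
      tMul σ q (Finsupp.single 2 (1 : D) - Finsupp.single 1 z₁ - Finsupp.single 0 z₀) + s) :
    r = s := by
  have hpq : p - q = 0 := by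
    refine eq_zero_of_tMul_quadratic σ z₀ z₁ _ fun n => ?_
    have hn := DFunLike.congr_fun h (n + 2)
    rw [Finsupp.add_apply, Finsupp.add_apply, hr, hs, add_zero, add_zero] at hn
    rw [tMul_sub_left, Finsupp.sub_apply, hn, sub_self]
  rw [sub_eq_zero.1 hpq] at h
  exact add_left_cancel h

theorem linear_apply_add_two (a b : D) (n : ℕ) :
    (Finsupp.single 1 a + Finsupp.single 0 b : ℕ →₀ D) (n + 2) = 0 := by
  simp

/-- Right division of `t⁴ − d` by `t² − z₁ t − z₀`, with explicit quotient. -/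
theorem quartic_division (z₀ z₁ d : D) :
    Finsupp.single 4 (1 : D) - Finsupp.single 0 d
      = tMul σ (Finsupp.single 2 1 + Finsupp.single 1 ((σ ^ 2) z₁)
            + Finsupp.single 0 ((σ ^ 2) z₁ * σ z₁ + (σ ^ 2) z₀))
          (Finsupp.single 2 (1 : D) - Finsupp.single 1 z₁ - Finsupp.single 0 z₀)
        + (Finsupp.single 1 ((σ ^ 2) z₁ * σ z₁ * z₁ + (σ ^ 2) z₀ * z₁ + (σ ^ 2) z₁ * σ z₀)
           + Finsupp.single 0 ((σ ^ 2) z₀ * z₀ + (σ ^ 2) z₁ * σ z₁ * z₀ - d)) := by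
  simp only [tMul_add_left, tMul_sub_right, tMul_single_single, map_one, mul_one, one_mul,
    pow_one, pow_zero, RingAut.one_apply, Finsupp.single_add, Finsupp.single_sub,
    Nat.reduceAdd]
  abel

end TwistedMultiplication

/-- The unique remainder of right division of `t⁴ − d` by
`g(t) = t² − z₁ t − z₀` in `D[t;σ]` equals
`[σ²(z₁)σ(z₁)z₁ + σ²(z₀)z₁ + σ²(z₁)σ(z₀)]·t + [σ²(z₀)z₀ + σ²(z₁)σ(z₁)z₀ − d]`.
In particular `g` right divides `t⁴ − d` iff
`σ²(z₁)σ(z₁)z₁ + σ²(z₀)z₁ + σ²(z₁)σ(z₀) = 0` and `σ²(z₀)z₀ + σ²(z₁)σ(z₁)z₀ = d`. -/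
theorem quartic_remainder {D : Type*} [DivisionRing D] (σ : D ≃+* D) (z₀ z₁ d : D) :
    (∃ q : ℕ →₀ D,
        Finsupp.single 4 (1 : D) - Finsupp.single 0 d
          = tMul σ q (Finsupp.single 2 (1 : D) - Finsupp.single 1 z₁ - Finsupp.single 0 z₀)
            + (Finsupp.single 1 ((σ ^ 2) z₁ * σ z₁ * z₁ + (σ ^ 2) z₀ * z₁ + (σ ^ 2) z₁ * σ z₀)
               + Finsupp.single 0 ((σ ^ 2) z₀ * z₀ + (σ ^ 2) z₁ * σ z₁ * z₀ - d))) ∧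
    (∀ q r : ℕ →₀ D, tDeg r < (2 : ℕ) →
        Finsupp.single 4 (1 : D) - Finsupp.single 0 d
          = tMul σ q (Finsupp.single 2 (1 : D) - Finsupp.single 1 z₁ - Finsupp.single 0 z₀) + r →
        r = Finsupp.single 1 ((σ ^ 2) z₁ * σ z₁ * z₁ + (σ ^ 2) z₀ * z₁ + (σ ^ 2) z₁ * σ z₀)
            + Finsupp.single 0 ((σ ^ 2) z₀ * z₀ + (σ ^ 2) z₁ * σ z₁ * z₀ - d)) ∧
    ((∃ q : ℕ →₀ D,
        Finsupp.single 4 (1 : D) - Finsupp.single 0 d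
          = tMul σ q (Finsupp.single 2 (1 : D) - Finsupp.single 1 z₁ - Finsupp.single 0 z₀)) ↔
      ((σ ^ 2) z₁ * σ z₁ * z₁ + (σ ^ 2) z₀ * z₁ + (σ ^ 2) z₁ * σ z₀ = 0 ∧
        (σ ^ 2) z₀ * z₀ + (σ ^ 2) z₁ * σ z₁ * z₀ = d)) := by
  have hdiv := quartic_division σ z₀ z₁ d
  refine ⟨⟨_, hdiv⟩, fun q r hr hq => ?_, ⟨fun ⟨q, hq⟩ => ?_, fun ⟨h₁, h₀⟩ => ?_⟩⟩
  · exact remainder_unique σ z₀ z₁ (fun n => apply_eq_zero_of_tDeg_lt hr (by omega))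
      (linear_apply_add_two _ _) (hq.symm.trans hdiv)
  · rw [← add_zero (tMul σ q _)] at hq
    have hrem := remainder_unique σ z₀ z₁ (fun _ => rfl) (linear_apply_add_two _ _)
      (hq.symm.trans hdiv)
    constructor
    · simpa using (DFunLike.congr_fun hrem 1).symm
    · simpa [sub_eq_zero] using (DFunLike.congr_fun hrem 0).symm
  · rw [h₁, h₀, sub_self, Finsupp.single_zero, Finsupp.single_zero, add_zero, add_zero] at hdiv
    exact ⟨_, hdiv⟩
end
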